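/- Let T be an essentially small, Krull–Schmidt, k-linear, Hom-finite triangulated category over a commutative ring k with a basic silting object s, and set S = add(s). If u ∈ S * ΣS is a basic presilting object, then u is a silting object if and only if the number of pairwise non-isomorphic indecomposable direct summands of u equals that of s. -/

import Mathlib

open CategoryTheory Category Limits Pretriangulated

variable {C : Type*} [Category C] [Preadditive C] [HasZeroObject C] [HasShift C ℤ]
  [∀ n : ℤ, (shiftFunctor C n).Additive] [Pretriangulated C] [HasFiniteBiproducts C]

/-- `add(s)`: direct summands of finite direct sums of copies of `s`. -/
def addSet (s : C) : Set C :=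
  {x | ∃ (n : ℕ) (i : x ⟶ ⨁ (fun _ : Fin n => s)) (r : (⨁ fun _ : Fin n => s) ⟶ x),
    i ≫ r = 𝟙 x}

/-- `S * ΣS` for `S = add(s)`: objects `t` admitting a distinguished triangle
`s₁ → s₀ → t → Σs₁` with `s₀, s₁ ∈ add(s)`. -/
def twoTermOf (s : C) : Set C :=
  {t | ∃ (s₁ s₀ : C) (_ : s₁ ∈ addSet s) (_ : s₀ ∈ addSet s) (f : s₁ ⟶ s₀)
    (g : s₀ ⟶ t) (h : t ⟶ s₁⟦(1 : ℤ)⟧), Triangle.mk f g h ∈ distTriang C}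

/-- A class closed under isomorphisms, shifts, extensions and direct summands. -/
def IsThickSet (P : Set C) : Prop :=
  (∀ x y : C, Nonempty (x ≅ y) → x ∈ P → y ∈ P) ∧
  (∀ x ∈ P, x⟦(1 : ℤ)⟧ ∈ P) ∧
  (∀ x ∈ P, x⟦(-1 : ℤ)⟧ ∈ P) ∧
  (∀ (x y z : C) (f : x ⟶ y) (g : y ⟶ z) (w : z ⟶ x⟦(1 : ℤ)⟧),
    Triangle.mk f g w ∈ (distTriang C) → x ∈ P → z ∈ P → y ∈ P) ∧
  (∀ x y : C, (∃ (i : x ⟶ y) (r : y ⟶ x), i ≫ r = 𝟙 x) → y ∈ P → x ∈ P)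

/-- `u` is a presilting object: `Hom(u, Σⁱu) = 0` for all `i ≥ 1`. -/
def PresiltingObj (u : C) : Prop := ∀ i : ℤ, 1 ≤ i → ∀ f : u ⟶ u⟦i⟧, f = 0

/-- `u` is a silting object: presilting and `thick(u) = C`. -/
def SiltingObj (u : C) : Prop :=
  PresiltingObj u ∧ ∀ P : Set C, IsThickSet P → u ∈ P → ∀ x : C, x ∈ P

/-- A decomposition of `x` into `n` pairwise non-isomorphic indecomposable (local
endomorphism ring) direct summands; witnesses that `x` is basic with `#(x) = n`. -/
def BasicDecomp (x : C) (n : ℕ) (f : Fin n → C) : Prop :=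
  (∀ i, IsLocalRing (End (f i))) ∧
  (∀ i j, Nonempty (f i ≅ f j) → i = j) ∧
  Nonempty (x ≅ ⨁ f)

/-- Krull–Schmidt: every object is a finite direct sum of objects with local
endomorphism rings. -/
def KrullSchmidt (C : Type*) [Category C] [Preadditive C] [HasFiniteBiproducts C] : Prop :=
  ∀ x : C, ∃ (n : ℕ) (f : Fin n → C),
    (∀ i, IsLocalRing (End (f i))) ∧ Nonempty (x ≅ ⨁ f)

set_option linter.unusedSectionVars false

section Exactness

variable {x y z a : C} {f : x ⟶ y} {g : y ⟶ z} {h : z ⟶ x⟦(1 : ℤ)⟧}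
  (hT : Triangle.mk f g h ∈ distTriang C)
include hT

lemma comp_eq_zero₁₂ : f ≫ g = 0 := comp_distTriang_mor_zero₁₂ _ hT

lemma exists_lift₂ (t : a ⟶ y) (ht : t ≫ g = 0) : ∃ t' : a ⟶ x, t = t' ≫ f :=
  Triangle.coyoneda_exact₂ _ hT t ht

lemma exists_lift₃ (t : a ⟶ z) (ht : t ≫ h = 0) : ∃ t' : a ⟶ y, t = t' ≫ g :=
  Triangle.coyoneda_exact₃ _ hT t ht

lemma exists_extend₂ (t : y ⟶ a) (ht : f ≫ t = 0) : ∃ t' : z ⟶ a, t = g ≫ t' :=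
  Triangle.yoneda_exact₂ _ hT t ht

lemma exists_extend₃ (t : z ⟶ a) (ht : g ≫ t = 0) : ∃ t' : x⟦(1 : ℤ)⟧ ⟶ a, t = h ≫ t' :=
  Triangle.yoneda_exact₃ _ hT t ht

end Exactness

section Vanishing

/-- `Hom(X, ΣⁿY) = 0`. -/
def HomVanish (X Y : C) (n : ℤ) : Prop := ∀ f : X ⟶ Y⟦n⟧, f = 0

lemma homVanish_shift_right {X Y : C} (a n : ℤ) :
    HomVanish X (Y⟦a⟧) n ↔ HomVanish X Y (a + n) := by
  let e : Y⟦a + n⟧ ≅ Y⟦a⟧⟦n⟧ := (shiftFunctorAdd C a n).app Y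
  constructor
  · intro h f
    rw [← cancel_mono e.hom, zero_comp]
    exact h _
  · intro h f
    rw [← cancel_mono e.inv, zero_comp]
    exact h _

lemma homVanish_shift_left {X Y : C} (a n : ℤ) :
    HomVanish (X⟦a⟧) Y n ↔ HomVanish X Y (n - a) := by
  let e : Y⟦n⟧ ≅ Y⟦n - a⟧⟦a⟧ := (shiftFunctorAdd' C (n - a) a n (by lia)).app Y
  constructor
  · intro h f
    apply (shiftFunctor C a).map_injective
    rw [Functor.map_zero, ← cancel_mono e.inv, zero_comp]
    exact h _
  · intro h f
    rw [← cancel_mono e.hom, zero_comp, ← (shiftFunctor C a).map_preimage (f ≫ e.hom),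
      h ((shiftFunctor C a).preimage (f ≫ e.hom)), Functor.map_zero]

lemma HomVanish.eq_zero {X Y : C} (h : HomVanish X Y 0) (f : X ⟶ Y) : f = 0 := by
  let e : Y⟦(0 : ℤ)⟧ ≅ Y := (shiftFunctorZero C ℤ).app Y
  rw [← cancel_mono e.inv, zero_comp]
  exact h _

lemma homVanish_zero_of_forall {X Y : C} (h : ∀ f : X ⟶ Y, f = 0) : HomVanish X Y 0 := by
  intro f
  let e : Y⟦(0 : ℤ)⟧ ≅ Y := (shiftFunctorZero C ℤ).app Y
  rw [← cancel_mono e.hom, zero_comp]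
  exact h _

lemma HomVanish.of_iso {X X' Y Y' : C} {n : ℤ} (e : X ≅ X') (e' : Y ≅ Y')
    (h : HomVanish X Y n) : HomVanish X' Y' n := by
  intro f
  have := h (e.hom ≫ f ≫ e'.inv⟦n⟧')
  rwa [← cancel_epi e.hom, ← cancel_mono (e'.inv⟦n⟧'), comp_zero, zero_comp, assoc]

section Triangle

variable {T : Triangle C} (hT : T ∈ distTriang C) {X : C} {n : ℤ}
include hT

lemma HomVanish.obj₂ (h₁ : HomVanish X T.obj₁ n) (h₃ : HomVanish X T.obj₃ n) :
    HomVanish X T.obj₂ n := by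
  intro f
  obtain ⟨g, hg⟩ := Triangle.coyoneda_exact₂ _ (Triangle.shift_distinguished T hT n) f (h₃ _)
  rw [hg, h₁ g]
  exact zero_comp

lemma HomVanish.obj₃ (h₂ : HomVanish X T.obj₂ n) (h₁ : HomVanish X T.obj₁ (1 + n)) :
    HomVanish X T.obj₃ n :=
  HomVanish.obj₂ (rot_of_distTriang _ hT) h₂ ((homVanish_shift_right 1 n).2 h₁)

lemma HomVanish.obj₁ (h₂ : HomVanish X T.obj₂ n) (h₃ : HomVanish X T.obj₃ (-1 + n)) :
    HomVanish X T.obj₁ n :=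
  HomVanish.obj₂ (inv_rot_of_distTriang _ hT) ((homVanish_shift_right (-1) n).2 h₃) h₂

lemma HomVanish.obj₂' (h₁ : HomVanish T.obj₁ X n) (h₃ : HomVanish T.obj₃ X n) :
    HomVanish T.obj₂ X n := by
  intro f
  obtain ⟨g, hg⟩ := Triangle.yoneda_exact₂ _ hT f (h₁ _)
  rw [hg, h₃ g, comp_zero]

lemma HomVanish.obj₃' (h₂ : HomVanish T.obj₂ X n) (h₁ : HomVanish T.obj₁ X (n - 1)) :
    HomVanish T.obj₃ X n :=
  HomVanish.obj₂' (rot_of_distTriang _ hT) h₂ ((homVanish_shift_left 1 n).2 h₁)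

lemma HomVanish.obj₁' (h₂ : HomVanish T.obj₂ X n) (h₃ : HomVanish T.obj₃ X (n + 1)) :
    HomVanish T.obj₁ X n :=
  HomVanish.obj₂' (inv_rot_of_distTriang _ hT)
    ((homVanish_shift_left (-1) n).2 (by rwa [sub_neg_eq_add])) h₂

end Triangle

end Vanishing

section AddClosure

lemma mem_addSet_of_sum {s x : C} {ι : Type*} [Fintype ι] (i : ι → (x ⟶ s)) (r : ι → (s ⟶ x))
    (h : ∑ j, i j ≫ r j = 𝟙 x) : x ∈ addSet s := by
  let e := Fintype.equivFin ι
  refine ⟨Fintype.card ι, biproduct.lift fun k => i (e.symm k),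
    biproduct.desc fun k => r (e.symm k), ?_⟩
  rw [biproduct.lift_desc, ← h]
  exact e.symm.sum_comp fun j => i j ≫ r j

lemma exists_sum_of_mem_addSet {s x : C} (h : x ∈ addSet s) :
    ∃ (n : ℕ) (i : Fin n → (x ⟶ s)) (r : Fin n → (s ⟶ x)), ∑ j, i j ≫ r j = 𝟙 x := by
  obtain ⟨n, i, r, hir⟩ := h
  refine ⟨n, fun j => i ≫ biproduct.π _ j, fun j => biproduct.ι (fun _ : Fin n => s) j ≫ r, ?_⟩
  calc _ = i ≫ (∑ j, biproduct.π (fun _ : Fin n => s) j ≫ biproduct.ι (fun _ : Fin n => s) j) ≫ r := by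
        simp only [Preadditive.sum_comp, Preadditive.comp_sum, assoc]
    _ = _ := by rw [biproduct.total, id_comp, hir]

lemma mem_addSet_self (s : C) : s ∈ addSet s :=
  mem_addSet_of_sum (ι := Unit) (fun _ => 𝟙 s) (fun _ => 𝟙 s) (by simp)

lemma mem_addSet_of_retract {s x y : C} (i : x ⟶ y) (r : y ⟶ x) (h : i ≫ r = 𝟙 x)
    (hy : y ∈ addSet s) : x ∈ addSet s := by
  obtain ⟨n, i', r', hir⟩ := exists_sum_of_mem_addSet hy
  refine mem_addSet_of_sum (fun j => i ≫ i' j) (fun j => r' j ≫ r) ?_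
  calc _ = i ≫ (∑ j, i' j ≫ r' j) ≫ r := by
        simp [Preadditive.sum_comp, Preadditive.comp_sum]
    _ = _ := by rw [hir, id_comp, h]

lemma mem_addSet_of_iso {s x y : C} (e : x ≅ y) (hy : y ∈ addSet s) : x ∈ addSet s :=
  mem_addSet_of_retract e.hom e.inv e.hom_inv_id hy

lemma addSet_trans {s t x : C} (hx : x ∈ addSet t) (ht : t ∈ addSet s) : x ∈ addSet s := by
  obtain ⟨n, i, r, h⟩ := exists_sum_of_mem_addSet hx
  obtain ⟨n', i', r', h'⟩ := exists_sum_of_mem_addSet ht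
  refine mem_addSet_of_sum (ι := Fin n × Fin n') (fun j => i j.1 ≫ i' j.2)
    (fun j => r' j.2 ≫ r j.1) ?_
  rw [Fintype.sum_prod_type, ← h]
  refine Finset.sum_congr rfl fun j _ => ?_
  calc _ = i j ≫ (∑ k, i' k ≫ r' k) ≫ r j := by
        simp [Preadditive.sum_comp, Preadditive.comp_sum]
    _ = _ := by rw [h', id_comp]

lemma biproduct_mem_addSet {s : C} {n : ℕ} {f : Fin n → C} (h : ∀ j, f j ∈ addSet s) :
    (⨁ f) ∈ addSet s := by
  choose N i r hir using fun j => exists_sum_of_mem_addSet (h j)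
  refine mem_addSet_of_sum (ι := Σ j, Fin (N j)) (fun j => biproduct.π f j.1 ≫ i j.1 j.2)
    (fun j => r j.1 j.2 ≫ biproduct.ι f j.1) ?_
  rw [Fintype.sum_sigma, ← biproduct.total]
  refine Finset.sum_congr rfl fun j _ => ?_
  calc _ = biproduct.π f j ≫ (∑ k, i j k ≫ r j k) ≫ biproduct.ι f j := by
        simp [Preadditive.sum_comp, Preadditive.comp_sum]
    _ = _ := by rw [hir, id_comp]

lemma biprod_mem_addSet {s x y : C} (hx : x ∈ addSet s) (hy : y ∈ addSet s) :
    (x ⊞ y) ∈ addSet s := by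
  obtain ⟨n, i, r, h⟩ := exists_sum_of_mem_addSet hx
  obtain ⟨n', i', r', h'⟩ := exists_sum_of_mem_addSet hy
  refine mem_addSet_of_sum (ι := Fin n ⊕ Fin n')
    (Sum.elim (fun j => biprod.fst ≫ i j) (fun j => biprod.snd ≫ i' j))
    (Sum.elim (fun j => r j ≫ biprod.inl) (fun j => r' j ≫ biprod.inr)) ?_
  rw [Fintype.sum_sum_type, ← biprod.total]
  congr 1
  · calc _ = biprod.fst ≫ (∑ k, i k ≫ r k) ≫ biprod.inl := by
          simp [Preadditive.sum_comp, Preadditive.comp_sum]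
      _ = _ := by rw [h, id_comp]
  · calc _ = biprod.snd ≫ (∑ k, i' k ≫ r' k) ≫ biprod.inr := by
          simp [Preadditive.sum_comp, Preadditive.comp_sum]
      _ = _ := by rw [h', id_comp]

lemma summand_mem_addSet {n : ℕ} {f : Fin n → C} {x : C} (e : x ≅ ⨁ f) (j : Fin n) :
    f j ∈ addSet x :=
  mem_addSet_of_retract (biproduct.ι f j ≫ e.inv) (e.hom ≫ biproduct.π f j) (by simp)
    (mem_addSet_self x)

lemma HomVanish.of_mem_left {s x Y : C} {n : ℤ} (hx : x ∈ addSet s) (h : HomVanish s Y n) :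
    HomVanish x Y n := by
  intro f
  obtain ⟨N, i, r, hir⟩ := exists_sum_of_mem_addSet hx
  rw [← id_comp f, ← hir, Preadditive.sum_comp]
  exact Finset.sum_eq_zero fun j _ => by rw [assoc, h (r j ≫ f), comp_zero]

lemma HomVanish.of_mem_right {s x Y : C} {n : ℤ} (hx : x ∈ addSet s) (h : HomVanish Y s n) :
    HomVanish Y x n := by
  intro f
  obtain ⟨N, i, r, hir⟩ := exists_sum_of_mem_addSet hx
  rw [← comp_id f, ← (shiftFunctor C n).map_id, ← hir, Functor.map_sum, Preadditive.comp_sum]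
  exact Finset.sum_eq_zero fun j _ => by
    rw [Functor.map_comp, ← assoc, h (f ≫ (i j)⟦n⟧'), zero_comp]

end AddClosure

section Approximation

variable (k : Type*) [CommRing k] [Linear k C]
  (hfin : ∀ X Y : C, Module.Finite k (X ⟶ Y))
include hfin

lemma exists_right_approx (q x : C) :
    ∃ (a : C) (_ : a ∈ addSet q) (t : a ⟶ x), ∀ f : q ⟶ x, ∃ f', f = f' ≫ t := by
  obtain ⟨n, v, hv⟩ := (hfin q x).exists_fin
  refine ⟨⨁ fun _ : Fin n => q, biproduct_mem_addSet fun _ => mem_addSet_self q,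
    biproduct.desc v, fun f => ?_⟩
  obtain ⟨c, hc⟩ := (Submodule.mem_span_range_iff_exists_fun k).1
    (hv.ge (Submodule.mem_top : f ∈ ⊤))
  refine ⟨∑ j, c j • biproduct.ι (fun _ : Fin n => q) j, ?_⟩
  simp [Preadditive.sum_comp, hc]

lemma exists_left_approx (x q : C) :
    ∃ (a : C) (_ : a ∈ addSet q) (t : x ⟶ a), ∀ f : x ⟶ q, ∃ f', f = t ≫ f' := by
  obtain ⟨n, v, hv⟩ := (hfin x q).exists_fin
  refine ⟨⨁ fun _ : Fin n => q, biproduct_mem_addSet fun _ => mem_addSet_self q,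
    biproduct.lift v, fun f => ?_⟩
  obtain ⟨c, hc⟩ := (Submodule.mem_span_range_iff_exists_fun k).1
    (hv.ge (Submodule.mem_top : f ∈ ⊤))
  refine ⟨∑ j, c j • biproduct.π (fun _ : Fin n => q) j, ?_⟩
  simp [Preadditive.comp_sum, hc]

end Approximation

section Thick

lemma IsThickSet.mem_of_mem_addSet {P : Set C} (hP : IsThickSet P) {s x : C} (hs : s ∈ P)
    (hx : x ∈ addSet s) : x ∈ P := by
  obtain ⟨hiso, hsh, hsh', hext, hret⟩ := hP
  obtain ⟨n, i, r, hir⟩ := hx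
  refine hret _ _ ⟨i, r, hir⟩ ?_
  clear hir i r
  have h0 : ∀ z : C, IsZero z → z ∈ P := fun z hz =>
    hret z s ⟨0, 0, hz.eq_of_src _ _⟩ hs
  have hbi : ∀ a b : C, a ∈ P → b ∈ P → (a ⊞ b) ∈ P := fun a b ha hb =>
    hext a (a ⊞ b) b _ _ _ (binaryBiproductTriangle_distinguished a b) ha hb
  induction n with
  | zero => exact h0 _ ((IsZero.iff_id_eq_zero _).2 (by ext j; exact j.elim0))
  | succ n ih =>
    refine hret _ _ ⟨biprod.lift (biproduct.π _ 0) (biproduct.lift fun j => biproduct.π _ j.succ),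
      biprod.desc (biproduct.ι (fun _ : Fin (n + 1) => s) 0)
        (biproduct.desc fun j => biproduct.ι (fun _ : Fin (n + 1) => s) j.succ), ?_⟩
      (hbi _ _ hs ih)
    rw [biprod.lift_desc, biproduct.lift_desc, ← biproduct.total, Fin.sum_univ_succ]

/-- The objects admitting no nonzero morphism to objects far enough in the coaisle defined by `q`
form a thick set. -/
lemma isThickSet_homVanish (q : C) :
    IsThickSet {y : C | ∃ L : ℤ, ∀ z : C, (∀ i : ℤ, -L ≤ i → HomVanish q z i) →
      HomVanish y z 0} := by
  refine ⟨?_, ?_, ?_, ?_, ?_⟩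
  · rintro x y ⟨e⟩ ⟨L, hL⟩
    exact ⟨L, fun z hz => (hL z hz).of_iso e (Iso.refl z)⟩
  · rintro x ⟨L, hL⟩
    refine ⟨L + 1, fun z hz => ?_⟩
    rw [homVanish_shift_left, zero_sub, ← add_zero (-1), ← homVanish_shift_right]
    refine hL _ fun i hi => ?_
    rw [homVanish_shift_right]
    exact hz _ (by lia)
  · rintro x ⟨L, hL⟩
    refine ⟨L - 1, fun z hz => ?_⟩
    rw [homVanish_shift_left, zero_sub, neg_neg, ← add_zero 1, ← homVanish_shift_right]
    refine hL _ fun i hi => ?_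
    rw [homVanish_shift_right]
    exact hz _ (by lia)
  · rintro x y z f g w hT ⟨L, hL⟩ ⟨L', hL'⟩
    refine ⟨max L L', fun v hv => ?_⟩
    exact HomVanish.obj₂' hT (hL v fun i hi => hv i (by lia))
      (hL' v fun i hi => hv i (by lia))
  · rintro x y ⟨i, r, hir⟩ ⟨L, hL⟩
    refine ⟨L, fun z hz f => ?_⟩
    rw [← id_comp f, ← hir, assoc, hL z hz (r ≫ f), comp_zero]

variable (k : Type*) [CommRing k] [Linear k C]
  (hfin : ∀ X Y : C, Module.Finite k (X ⟶ Y))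
include hfin

/-- An object that is `Ext`-orthogonal on both sides to a silting object `q` lies in `add(q)`. -/
lemma SiltingObj.mem_addSet {q : C} (hq : SiltingObj q) {c : C}
    (h₁ : ∀ i : ℤ, 1 ≤ i → HomVanish q c i) (h₂ : ∀ i : ℤ, 1 ≤ i → HomVanish c q i) :
    c ∈ addSet q := by
  obtain ⟨L, hL⟩ := hq.2 _ (isThickSet_homVanish q)
    ⟨0, fun z hz => hz 0 (by simp)⟩ c
  have step : ∀ (j : ℤ) (x : C), (∀ i : ℤ, 1 - j ≤ i → HomVanish q x i) →
      ∃ (a x' : C) (_ : a ∈ addSet q) (f : a⟦j⟧ ⟶ x) (g : x ⟶ x') (h : x' ⟶ a⟦j⟧⟦(1 : ℤ)⟧),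
        Triangle.mk f g h ∈ distTriang C ∧ ∀ i : ℤ, -j ≤ i → HomVanish q x' i := by
    intro j x hx
    obtain ⟨a, ha, t, ht⟩ := exists_right_approx k hfin q (x⟦-j⟧)
    let e : x⟦-j⟧⟦j⟧ ≅ x := shiftNegShift x j
    have hv : ∀ i : ℤ, 1 - j ≤ i → HomVanish q (a⟦j⟧) i := fun i hi =>
      (homVanish_shift_right _ _).2 (.of_mem_right ha (hq.1 _ (by lia)))
    obtain ⟨x', g, h, hT⟩ := distinguished_cocone_triangle (t⟦j⟧' ≫ e.hom)
    refine ⟨a, x', ha, _, g, h, hT, fun i hi => ?_⟩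
    rcases hi.eq_or_lt with rfl | hi
    · rw [← zero_sub, ← homVanish_shift_left]
      apply homVanish_zero_of_forall
      intro f
      obtain ⟨f', rfl⟩ := exists_lift₃ hT f
        ((homVanish_shift_left _ _).2 (hv (1 - j) le_rfl) _)
      obtain ⟨f₀, hf₀⟩ := (shiftFunctor C j).map_surjective (f' ≫ e.inv)
      obtain ⟨f₁, rfl⟩ := ht f₀
      have hf' : f' = f₁⟦j⟧' ≫ t⟦j⟧' ≫ e.hom := by
        rw [← assoc, ← Functor.map_comp, hf₀, assoc, e.inv_hom_id, comp_id]
      rw [hf', assoc, comp_eq_zero₁₂ hT, comp_zero]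
    · exact HomVanish.obj₃ hT (hx _ (by lia)) (hv _ (by lia))
  have claim : ∀ (N : ℕ) (j : ℤ), 1 ≤ j → L ≤ j - 1 + N → ∀ x : C,
      (∀ i : ℤ, 1 - j ≤ i → HomVanish q x i) → ∀ f : c ⟶ x, f = 0 := by
    intro N
    induction N with
    | zero => exact fun j _ hj' x hx f =>
        (hL x fun i hi => hx i (by push_cast at hj'; lia)).eq_zero f
    | succ N ih =>
      intro j hj hj' x hx f
      obtain ⟨a, x', ha, t, g, h, hT, hx'⟩ := step j x hx
      obtain ⟨f', rfl⟩ := exists_lift₂ hT f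
        (ih (j + 1) (by lia) (by push_cast at hj'; lia) x' (fun i hi => hx' i (by lia)) _)
      have : f' = 0 := HomVanish.of_mem_right ha (h₂ j hj) f'
      rw [this, zero_comp]
  obtain ⟨a, x', ha, t, g, h, hT, hx'⟩ := step 0 c (by simpa using h₁)
  obtain ⟨i, hi⟩ := exists_lift₂ hT (𝟙 c)
    (claim (L.toNat) 1 le_rfl (by simp) x' (by simpa using hx') _)
  exact mem_addSet_of_retract i t hi.symm
    (mem_addSet_of_iso ((shiftFunctorZero C ℤ).app a) ha)

end Thick

section Local

lemma isUnit_of_mul_eq_one_of_isLocalRing {R : Type*} [Ring R] [IsLocalRing R] {a b : R}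
    (h : a * b = 1) : IsUnit a ∧ IsUnit b := by
  have hba : b * a = 1 := by
    rcases IsLocalRing.isUnit_or_isUnit_of_add_one (add_sub_cancel (b * a) 1) with hu | hu
    · refine hu.mul_left_cancel ?_
      rw [mul_assoc, ← mul_assoc a, h, one_mul, mul_one]
    · have h0 : (1 - b * a) * b = 0 := by rw [sub_mul, mul_assoc, h, one_mul, mul_one, sub_self]
      have hb : b = 0 := hu.mul_right_eq_zero.1 h0
      simp [hb] at h
  exact ⟨⟨⟨a, b, h, hba⟩, rfl⟩, ⟨⟨b, a, hba, h⟩, rfl⟩⟩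

lemma isUnit_of_isUnit_mul_of_isLocalRing {R : Type*} [Ring R] [IsLocalRing R] {a b : R}
    (h : IsUnit (a * b)) : IsUnit a ∧ IsUnit b := by
  obtain ⟨u, hu⟩ := h
  constructor
  · exact (isUnit_of_mul_eq_one_of_isLocalRing (a := a) (b := b * ↑u⁻¹)
      (by rw [← mul_assoc, ← hu, Units.mul_inv])).1
  · exact (isUnit_of_mul_eq_one_of_isLocalRing (a := ↑u⁻¹ * a) (b := b)
      (by rw [mul_assoc, ← hu, Units.inv_mul])).2

lemma isUnit_end_iff_isIso {x : C} (f : x ⟶ x) : IsUnit (M := End x) f ↔ IsIso f :=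
  CategoryTheory.isUnit_iff_isIso f

lemma nonempty_iso_of_isIso_comp {a b : C} [IsLocalRing (End a)] [IsLocalRing (End b)]
    (f : a ⟶ b) (g : b ⟶ a) (h : IsIso (f ≫ g)) : Nonempty (a ≅ b) := by
  let r : b ⟶ a := g ≫ inv (f ≫ g)
  have hr : f ≫ r = 𝟙 a := by rw [← assoc, IsIso.hom_inv_id]
  let e : End b := r ≫ f
  rcases IsLocalRing.isUnit_or_isUnit_of_add_one (add_sub_cancel e 1) with hu | hu
  · refine ⟨⟨f, r, hr, hu.mul_left_cancel ?_⟩⟩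
    change (r ≫ f) ≫ (r ≫ f) = 𝟙 b ≫ (r ≫ f)
    rw [assoc, ← assoc f, hr, id_comp, id_comp]
  · exfalso
    have h0 : f ≫ (𝟙 b - r ≫ f) = 0 := by
      rw [Preadditive.comp_sub, ← assoc, hr, id_comp, comp_id, sub_self]
    have : IsIso (𝟙 b - r ≫ f) := (isUnit_end_iff_isIso _).1 hu
    have hf : f = 0 := by rw [← cancel_mono (𝟙 b - r ≫ f), h0, zero_comp]
    rw [hf, zero_comp] at hr
    exact one_ne_zero (α := End a) hr.symm

lemma exists_iso_of_mem_addSet {a s : C} [IsLocalRing (End a)] {n : ℕ} {f : Fin n → C}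
    (hf : ∀ i, IsLocalRing (End (f i))) (e : s ≅ ⨁ f) (ha : a ∈ addSet s) :
    ∃ j, Nonempty (a ≅ f j) := by
  obtain ⟨N, i, r, hir⟩ := exists_sum_of_mem_addSet ha
  have hsum : ∑ t, ∑ j, (i t ≫ e.hom ≫ biproduct.π f j) ≫ (biproduct.ι f j ≫ e.inv ≫ r t) =
      𝟙 a := by
    rw [← hir]
    refine Finset.sum_congr rfl fun t _ => ?_
    calc _ = i t ≫ e.hom ≫ (∑ j, biproduct.π f j ≫ biproduct.ι f j) ≫ e.inv ≫ r t := by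
          simp only [Preadditive.sum_comp, Preadditive.comp_sum, assoc]
      _ = _ := by rw [biproduct.total, id_comp, e.hom_inv_id_assoc]
  have hu : IsUnit (M := End a) (∑ t, ∑ j,
      ((i t ≫ e.hom ≫ biproduct.π f j) ≫ (biproduct.ι f j ≫ e.inv ≫ r t) : End a)) :=
    (show _ = (1 : End a) from hsum) ▸ isUnit_one
  obtain ⟨t, -, ht⟩ := IsLocalRing.exists_of_isUnit_sum hu
  obtain ⟨j, -, hj⟩ := IsLocalRing.exists_of_isUnit_sum ht
  have := hf j
  exact ⟨j, nonempty_iso_of_isIso_comp (i t ≫ e.hom ≫ biproduct.π f j)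
    (biproduct.ι f j ≫ e.inv ≫ r t) ((isUnit_end_iff_isIso _).1 hj)⟩

end Local

section Top

variable (p ℓ : C)

/-- `ρ` is a radical morphism to an object `ℓ` with local endomorphism ring. -/
def IsRadTo {a ℓ : C} (ρ : a ⟶ ℓ) : Prop := ∀ σ : ℓ ⟶ a, ¬ IsIso (σ ≫ ρ)

variable {p ℓ} in
lemma IsRadTo.comp {a b : C} {ρ : a ⟶ ℓ} (hρ : IsRadTo ρ) (r : b ⟶ a) : IsRadTo (r ≫ ρ) :=
  fun σ => by rw [← assoc]; exact hρ _

variable {p ℓ} in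
lemma IsRadTo.add [IsLocalRing (End ℓ)] {a : C} {ρ ρ' : a ⟶ ℓ} (h : IsRadTo ρ)
    (h' : IsRadTo ρ') : IsRadTo (ρ + ρ') := by
  intro σ hσ
  rw [Preadditive.comp_add] at hσ
  rcases IsLocalRing.isUnit_or_isUnit_of_isUnit_add (R := End ℓ)
    ((isUnit_end_iff_isIso (σ ≫ ρ + σ ≫ ρ')).2 hσ) with hu | hu
  · exact h σ ((isUnit_end_iff_isIso _).1 hu)
  · exact h' σ ((isUnit_end_iff_isIso _).1 hu)

variable {p ℓ} in
lemma IsRadTo.comp_end [IsLocalRing (End ℓ)] {a : C} {ρ : a ⟶ ℓ} (h : IsRadTo ρ)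
    (e : ℓ ⟶ ℓ) : IsRadTo (ρ ≫ e) := by
  intro σ hσ
  have : IsUnit (M := End ℓ) ((show End ℓ from e) * (show End ℓ from σ ≫ ρ)) :=
    (isUnit_end_iff_isIso ((σ ≫ ρ) ≫ e)).2 (by rwa [assoc])
  exact h σ ((isUnit_end_iff_isIso _).1 (isUnit_of_isUnit_mul_of_isLocalRing this).2)

variable {ℓ} in
lemma isRadTo_zero [IsLocalRing (End ℓ)] (a : C) : IsRadTo (0 : a ⟶ ℓ) := by
  intro σ hσ
  rw [comp_zero] at hσ
  exact not_isUnit_zero (M₀ := End ℓ) ((isUnit_end_iff_isIso (0 : ℓ ⟶ ℓ)).2 hσ)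

variable [IsLocalRing (End ℓ)]

/-- The morphisms `w ⟶ ℓ` that factor as a morphism to an object of `add(p)` followed by a
radical morphism. -/
def radSub (w : C) : Submodule (End ℓ) (w ⟶ ℓ) where
  carrier := {ξ | ∃ (a : C) (_ : a ∈ addSet p) (ψ : w ⟶ a) (ρ : a ⟶ ℓ), IsRadTo ρ ∧ ξ = ψ ≫ ρ}
  zero_mem' := by
    refine ⟨p, mem_addSet_self p, 0, 0, isRadTo_zero _, by simp⟩
  add_mem' := by
    rintro _ _ ⟨a, ha, ψ, ρ, hρ, rfl⟩ ⟨a', ha', ψ', ρ', hρ', rfl⟩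
    refine ⟨a ⊞ a', biprod_mem_addSet ha ha', biprod.lift ψ ψ',
      biprod.fst ≫ ρ + biprod.snd ≫ ρ', (hρ.comp _).add (hρ'.comp _), by simp⟩
  smul_mem' := by
    rintro e _ ⟨a, ha, ψ, ρ, hρ, rfl⟩
    exact ⟨a, ha, ψ, ρ ≫ e, hρ.comp_end e, by rw [End.smul_right, assoc]⟩

/-- The space of morphisms from `w` to the simple top of `ℓ`. -/
abbrev SimpleHom (w : C) : Type _ := (w ⟶ ℓ) ⧸ radSub p ℓ w

/-- Precomposition as an `End ℓ`-linear map. -/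
def precomp {w w' : C} (f : w' ⟶ w) : (w ⟶ ℓ) →ₗ[End ℓ] (w' ⟶ ℓ) where
  toFun φ := f ≫ φ
  map_add' _ _ := Preadditive.comp_add _ _ _ _ _ _
  map_smul' _ _ := by simp [End.smul_right]

/-- `SimpleHom` is a contravariant functor. -/
def simpleMap {w w' : C} (f : w' ⟶ w) : SimpleHom p ℓ w →ₗ[End ℓ] SimpleHom p ℓ w' :=
  Submodule.mapQ _ _ (precomp ℓ f) (by
    rintro _ ⟨a, ha, ψ, ρ, hρ, rfl⟩
    exact ⟨a, ha, f ≫ ψ, ρ, hρ, by simp [precomp]⟩)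

/-- The class of a morphism in `SimpleHom`. -/
abbrev simpleMk {w : C} (φ : w ⟶ ℓ) : SimpleHom p ℓ w := Submodule.Quotient.mk φ

lemma simpleMk_surjective {w : C} (κ : SimpleHom p ℓ w) : ∃ φ, simpleMk p ℓ φ = κ :=
  Submodule.Quotient.mk_surjective _ κ

lemma simpleMk_add {w : C} (φ φ' : w ⟶ ℓ) : simpleMk p ℓ (φ + φ') = simpleMk p ℓ φ + simpleMk p ℓ φ' := rfl

lemma simpleMk_eq_zero {w : C} {φ : w ⟶ ℓ} : simpleMk p ℓ φ = 0 ↔ φ ∈ radSub p ℓ w :=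
  Submodule.Quotient.mk_eq_zero _

lemma simpleMk_eq_zero_of_isRadTo {a w : C} (ha : a ∈ addSet p) (ψ : w ⟶ a) {ρ : a ⟶ ℓ}
    (hρ : IsRadTo ρ) : simpleMk p ℓ (ψ ≫ ρ) = 0 :=
  (simpleMk_eq_zero p ℓ).2 ⟨a, ha, ψ, ρ, hρ, rfl⟩

@[simp] lemma simpleMap_mk {w w' : C} (f : w' ⟶ w) (φ : w ⟶ ℓ) :
    simpleMap p ℓ f (simpleMk p ℓ φ) = simpleMk p ℓ (f ≫ φ) := rfl

lemma simpleMap_id (w : C) (κ : SimpleHom p ℓ w) : simpleMap p ℓ (𝟙 w) κ = κ := by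
  obtain ⟨φ, rfl⟩ := simpleMk_surjective p ℓ κ
  simp

lemma simpleMap_comp {w w' w'' : C} (f : w'' ⟶ w') (g : w' ⟶ w) (κ : SimpleHom p ℓ w) :
    simpleMap p ℓ (f ≫ g) κ = simpleMap p ℓ f (simpleMap p ℓ g κ) := by
  obtain ⟨φ, rfl⟩ := simpleMk_surjective p ℓ κ
  simp

/-- Natural transformations from `Hom(-, y)` to `SimpleHom` on `add(p)`. -/
def NatSimple (y : C) : Submodule (End ℓ)
    (∀ a : {a : C // a ∈ addSet p}, (a.1 ⟶ y) → SimpleHom p ℓ a.1) where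
  carrier := {τ | (∀ a f g, τ a (f + g) = τ a f + τ a g) ∧
    ∀ (a b : {a : C // a ∈ addSet p}) (r : b.1 ⟶ a.1) (f : a.1 ⟶ y),
      τ b (r ≫ f) = simpleMap p ℓ r (τ a f)}
  zero_mem' := by simp
  add_mem' := by
    rintro τ τ' ⟨h₁, h₂⟩ ⟨h₁', h₂'⟩
    refine ⟨fun a f g => ?_, fun a b r f => ?_⟩
    · simp only [Pi.add_apply, h₁, h₁']; abel
    · simp only [Pi.add_apply, h₂, h₂', map_add]
  smul_mem' := by
    rintro e τ ⟨h₁, h₂⟩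
    refine ⟨fun a f g => ?_, fun a b r f => ?_⟩
    · simp only [Pi.smul_apply, h₁, smul_add]
    · simp only [Pi.smul_apply, h₂, map_smul]

/-- `NatSimple` is a contravariant functor. -/
def natMap {y y' : C} (f : y ⟶ y') : NatSimple p ℓ y' →ₗ[End ℓ] NatSimple p ℓ y where
  toFun τ := ⟨fun a t => τ.1 a (t ≫ f), fun a s t => by
    dsimp only; rw [Preadditive.add_comp, τ.2.1],
    fun a b r t => by dsimp only; rw [assoc, τ.2.2]⟩
  map_add' _ _ := rfl
  map_smul' _ _ := rfl

lemma natMap_apply {y y' : C} (f : y ⟶ y') (τ : NatSimple p ℓ y') (a : {a : C // a ∈ addSet p})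
    (t : a.1 ⟶ y) : (natMap p ℓ f τ).1 a t = τ.1 a (t ≫ f) := rfl

/-- Evaluation at a morphism `f : x ⟶ y` with `x ∈ add(p)`. -/
def natEval {y x : C} (hx : x ∈ addSet p) (f : x ⟶ y) : NatSimple p ℓ y →ₗ[End ℓ] SimpleHom p ℓ x where
  toFun τ := τ.1 ⟨x, hx⟩ f
  map_add' _ _ := rfl
  map_smul' _ _ := rfl

lemma natEval_apply {y x : C} (hx : x ∈ addSet p) (f : x ⟶ y) (τ : NatSimple p ℓ y) :
    natEval p ℓ hx f τ = τ.1 ⟨x, hx⟩ f := rfl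

end Top

section Exact

/-- The connecting morphism of the inverse rotation of a triangle. -/
def invMor {x z : C} (h : z ⟶ x⟦(1 : ℤ)⟧) : z⟦(-1 : ℤ)⟧ ⟶ x :=
  -h⟦(-1 : ℤ)⟧' ≫ (shiftShiftNeg x (1 : ℤ)).hom

lemma invMor_comp_shift {x x' z : C} (h : z ⟶ x⟦(1 : ℤ)⟧) (v : x ⟶ x') :
    invMor (h ≫ v⟦(1 : ℤ)⟧') = invMor h ≫ v := by
  have : (v⟦(1 : ℤ)⟧')⟦(-1 : ℤ)⟧' ≫ (shiftShiftNeg x' (1 : ℤ)).hom =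
      (shiftShiftNeg x (1 : ℤ)).hom ≫ v :=
    (shiftEquiv C (1 : ℤ)).unitIso.inv.naturality v
  rw [invMor, invMor, Functor.map_comp, assoc, this,
    Preadditive.neg_comp, assoc]

lemma exists_map_of_comp_shift {x y z z₁ z₀ : C} {ι : x ⟶ y} {π : y ⟶ z} {δ : z ⟶ x⟦(1 : ℤ)⟧}
    {f : z₁ ⟶ z₀} {g : z₀ ⟶ z} {h : z ⟶ z₁⟦(1 : ℤ)⟧} (hT' : Triangle.mk f g h ∈ distTriang C)
    (hT : Triangle.mk ι π δ ∈ distTriang C) (v : z₁ ⟶ x) (hv : δ = h ≫ v⟦(1 : ℤ)⟧') :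
    ∃ l : z₀ ⟶ y, f ≫ l = v ≫ ι ∧ g = l ≫ π := by
  obtain ⟨l, h₁, h₂⟩ := complete_distinguished_triangle_morphism₂ _ _ hT' hT v (𝟙 z)
    (hv.symm.trans (id_comp δ).symm)
  exact ⟨l, h₁, (comp_id g).symm.trans h₂⟩

lemma exists_invMor_distinguished {x y z : C} {f : x ⟶ y} {g : y ⟶ z} {h : z ⟶ x⟦(1 : ℤ)⟧}
    (hT : Triangle.mk f g h ∈ distTriang C) :
    ∃ θ, Triangle.mk (invMor h) f θ ∈ distTriang C :=
  ⟨_, inv_rot_of_distTriang _ hT⟩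

lemma exists_extend₁ {x y z a : C} {f : x ⟶ y} {g : y ⟶ z} {h : z ⟶ x⟦(1 : ℤ)⟧}
    (hT : Triangle.mk f g h ∈ distTriang C) (ha : HomVanish z a 1) (t : x ⟶ a) :
    ∃ t' : y ⟶ a, t = f ≫ t' := by
  obtain ⟨θ, hθ⟩ := exists_invMor_distinguished hT
  refine exists_extend₂ hθ t (HomVanish.eq_zero ((homVanish_shift_left _ _).2 ?_) _)
  simpa using ha

lemma exists_lift_of_homVanish {x y z a : C} {f : x ⟶ y} {g : y ⟶ z} {h : z ⟶ x⟦(1 : ℤ)⟧}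
    (hT : Triangle.mk f g h ∈ distTriang C) (ha : HomVanish a x 1) (t : a ⟶ z) :
    ∃ t' : a ⟶ y, t = t' ≫ g :=
  exists_lift₃ hT t (ha _)

variable {p ℓ : C} [IsLocalRing (End ℓ)] {x y z : C} {ι : x ⟶ y} {π : y ⟶ z}
  {δ : z ⟶ x⟦(1 : ℤ)⟧} (hT : Triangle.mk ι π δ ∈ distTriang C) (hp : HomVanish p p 1)
  (hx : x ∈ addSet p)

include hp in
lemma homVanish_of_mem_addSet {a b : C} (ha : a ∈ addSet p) (hb : b ∈ addSet p) :
    HomVanish a b 1 := .of_mem_left ha (.of_mem_right hb hp)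

include hT hp hx in
lemma natMap_injective : Function.Injective (natMap p ℓ π) := by
  refine (injective_iff_map_eq_zero _).2 fun τ hτ => ?_
  ext a t : 3
  obtain ⟨t', rfl⟩ := exists_lift_of_homVanish hT (homVanish_of_mem_addSet hp a.2 hx) t
  exact congrFun (congrFun (congrArg Subtype.val hτ) a) t'

lemma NatSimple.map_sub {τ : NatSimple p ℓ y} {a : {a : C // a ∈ addSet p}} (s t : a.1 ⟶ y) :
    τ.1 a (s - t) = τ.1 a s - τ.1 a t := by
  have := τ.2.1 a (s - t) t
  rw [sub_add_cancel] at this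
  rw [this, add_sub_cancel_right]

lemma NatSimple.map_zero {τ : NatSimple p ℓ y} {a : {a : C // a ∈ addSet p}} :
    τ.1 a (0 : a.1 ⟶ y) = 0 := by
  simpa using NatSimple.map_sub (τ := τ) (a := a) 0 0

include hT hp in
lemma exact_natMap_natEval : Function.Exact (natMap p ℓ π) (natEval p ℓ hx ι) := by
  intro τ
  constructor
  · intro h
    have hlift (a : {a : C // a ∈ addSet p}) (t : a.1 ⟶ z) : ∃ t' : a.1 ⟶ y, t = t' ≫ π :=
      exists_lift_of_homVanish hT (homVanish_of_mem_addSet hp a.2 hx) t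
    choose lift hl using hlift
    have key (a : {a : C // a ∈ addSet p}) (s t : a.1 ⟶ y) (hst : s ≫ π = t ≫ π) :
        τ.1 a s = τ.1 a t := by
      obtain ⟨r, hr⟩ := exists_lift₂ hT (s - t) (by rw [Preadditive.sub_comp, hst, sub_self])
      rw [← sub_eq_zero, ← NatSimple.map_sub, hr, τ.2.2 ⟨x, hx⟩ a r ι]
      rw [natEval_apply] at h
      rw [h, map_zero]
    refine ⟨⟨fun a t => τ.1 a (lift a t), fun a s t => ?_, fun a b r t => ?_⟩, ?_⟩
    · dsimp only
      rw [← τ.2.1]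
      exact key _ _ _ (by rw [Preadditive.add_comp, ← hl, ← hl, ← hl])
    · dsimp only
      rw [← τ.2.2]
      exact key _ _ _ (by rw [assoc, ← hl, ← hl])
    · ext a t : 3
      exact key _ _ _ (hl _ _).symm
  · rintro ⟨σ, rfl⟩
    change σ.1 ⟨x, hx⟩ (ι ≫ π) = 0
    rw [comp_eq_zero₁₂ hT, NatSimple.map_zero]

variable {z₁ z₀ : C} {f : z₁ ⟶ z₀} {g : z₀ ⟶ z} {h : z ⟶ z₁⟦(1 : ℤ)⟧}
  (hT' : Triangle.mk f g h ∈ distTriang C) (hz₁ : z₁ ∈ addSet p) (hz₀ : z₀ ∈ addSet p)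
  (hℓ : ℓ ∈ addSet p)

include hT hp hT' hz₁ hz₀ in
lemma exact_natEval_simpleMap :
    Function.Exact (natEval p ℓ hx ι) (simpleMap p ℓ (invMor δ)) := by
  obtain ⟨θ, hω⟩ := exists_invMor_distinguished hT
  obtain ⟨θ', hη⟩ := exists_invMor_distinguished hT'
  obtain ⟨v', hv'⟩ := exists_extend₃ hT' δ (homVanish_of_mem_addSet hp hz₀ hx _)
  obtain ⟨v, rfl⟩ := (shiftFunctor C (1 : ℤ)).map_surjective v'
  obtain ⟨l, hl₁, hl₂⟩ := exists_map_of_comp_shift hT' hT v hv'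
  have hωη : invMor δ = invMor h ≫ v := by rw [hv', invMor_comp_shift]
  intro κ
  obtain ⟨φ, rfl⟩ := simpleMk_surjective p ℓ κ
  rw [simpleMap_mk]
  constructor
  · intro hφ
    obtain ⟨a, ha, ψ, ρ, hρ, hψ⟩ := (simpleMk_eq_zero p ℓ).1 hφ
    obtain ⟨ψ', rfl⟩ := exists_extend₁ hη (homVanish_of_mem_addSet hp hz₀ ha) ψ
    obtain ⟨χ, hχ⟩ := exists_extend₂ hη (v ≫ φ - ψ' ≫ ρ) (by
      rw [Preadditive.comp_sub, sub_eq_zero, ← assoc, ← hωη, hψ, assoc])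
    have hdec (a : {a : C // a ∈ addSet p}) (t : a.1 ⟶ y) :
        ∃ q : (a.1 ⟶ z₀) × (a.1 ⟶ x), t = q.1 ≫ l + q.2 ≫ ι := by
      obtain ⟨α, hα⟩ := exists_lift_of_homVanish hT' (homVanish_of_mem_addSet hp a.2 hz₁) (t ≫ π)
      obtain ⟨β, hβ⟩ := exists_lift₂ hT (t - α ≫ l) (by
        rw [Preadditive.sub_comp, hα, assoc, ← hl₂, sub_self])
      exact ⟨(α, β), by rw [← hβ, add_sub_cancel]⟩
    choose q hq using hdec
    have key₀ (a : C) (ha' : a ∈ addSet p) (α : a ⟶ z₀) (β : a ⟶ x) (h0 : α ≫ l + β ≫ ι = 0) :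
        simpleMk p ℓ (α ≫ χ + β ≫ φ) = 0 := by
      obtain ⟨γ, rfl⟩ := exists_lift₂ hT' α (by
        have := congrArg (· ≫ π) h0
        simpa [← hl₂, comp_eq_zero₁₂ hT] using this)
      obtain ⟨ε, hε⟩ := exists_lift₂ hω (γ ≫ v + β) (by
        rw [Preadditive.add_comp, assoc, ← hl₁, ← assoc, h0])
      have hβ : β = (ε ≫ invMor h - γ) ≫ v := by
        rw [Preadditive.sub_comp, assoc, ← hωη, ← hε, add_sub_cancel_left]
      have hα : γ ≫ f = (γ - ε ≫ invMor h) ≫ f := by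
        rw [Preadditive.sub_comp, assoc ε, comp_eq_zero₁₂ hη, comp_zero, sub_zero]
      have : (γ ≫ f) ≫ χ + β ≫ φ = ((ε ≫ invMor h - γ) ≫ ψ') ≫ ρ := by
        have hvφ : v ≫ φ = f ≫ χ + ψ' ≫ ρ := by rw [← hχ, sub_add_cancel]
        rw [hα, hβ, assoc _ v, hvφ]
        simp only [assoc, Preadditive.sub_comp, Preadditive.comp_add]
        abel
      rw [this]
      exact simpleMk_eq_zero_of_isRadTo p ℓ ha _ hρ
    have key (a : C) (ha' : a ∈ addSet p) (α α' : a ⟶ z₀) (β β' : a ⟶ x)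
        (h0 : α ≫ l + β ≫ ι = α' ≫ l + β' ≫ ι) :
        simpleMk p ℓ (α ≫ χ + β ≫ φ) = simpleMk p ℓ (α' ≫ χ + β' ≫ φ) := by
      have := key₀ a ha' (α - α') (β - β') (by
        rw [Preadditive.sub_comp, Preadditive.sub_comp, sub_add_sub_comm, h0, sub_self])
      rw [Preadditive.sub_comp, Preadditive.sub_comp, sub_add_sub_comm] at this
      rwa [← sub_eq_zero]
    refine ⟨⟨fun a t => simpleMk p ℓ ((q a t).1 ≫ χ + (q a t).2 ≫ φ), fun a s t => ?_,
      fun a b r t => ?_⟩, ?_⟩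
    · dsimp only
      rw [← simpleMk_add, key a.1 a.2 _ ((q a s).1 + (q a t).1) _ ((q a s).2 + (q a t).2)]
      · congr 1
        simp only [Preadditive.add_comp]
        abel
      · rw [← hq, Preadditive.add_comp, Preadditive.add_comp, add_add_add_comm, ← hq, ← hq]
    · dsimp only
      rw [simpleMap_mk, key b.1 b.2 _ (r ≫ (q a t).1) _ (r ≫ (q a t).2)]
      · simp only [Preadditive.comp_add, assoc]
      · rw [← hq, assoc, assoc, ← Preadditive.comp_add, ← hq]
    · rw [natEval_apply]
      dsimp only
      rw [key x hx _ 0 _ (𝟙 x)]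
      · simp
      · rw [← hq ⟨x, hx⟩ ι]; simp
  · rintro ⟨τ, hτ⟩
    rw [natEval_apply] at hτ
    obtain ⟨χ, hχ⟩ := simpleMk_surjective p ℓ (τ.1 ⟨z₀, hz₀⟩ l)
    have : simpleMk p ℓ (v ≫ φ) = simpleMk p ℓ (f ≫ χ) := by
      rw [← simpleMap_mk, ← simpleMap_mk, ← hτ, hχ, ← τ.2.2 ⟨x, hx⟩ ⟨z₁, hz₁⟩,
        ← τ.2.2 ⟨z₀, hz₀⟩ ⟨z₁, hz₁⟩, hl₁]
    rw [hωη, assoc, ← simpleMap_mk, this, simpleMap_mk, ← assoc, comp_eq_zero₁₂ hη, zero_comp]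
    rfl

include hT hp hx hℓ in
lemma exists_exact_simpleMap : ∃ μ : y⟦(-1 : ℤ)⟧ ⟶ z⟦(-1 : ℤ)⟧,
    Function.Exact (simpleMap p ℓ (invMor δ)) (simpleMap p ℓ μ) ∧
      Function.Surjective (simpleMap p ℓ μ) := by
  obtain ⟨θ, hω⟩ := exists_invMor_distinguished hT
  obtain ⟨θ', hμ⟩ := exists_invMor_distinguished hω
  refine ⟨invMor θ, fun κ => ?_, fun κ => ?_⟩
  · obtain ⟨φ, rfl⟩ := simpleMk_surjective p ℓ κ
    rw [simpleMap_mk]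
    constructor
    · intro hφ
      obtain ⟨a, ha, ψ, ρ, hρ, hψ⟩ := (simpleMk_eq_zero p ℓ).1 hφ
      obtain ⟨ψ', rfl⟩ := exists_extend₁ hμ (homVanish_of_mem_addSet hp hx ha) ψ
      obtain ⟨φ', hφ'⟩ := exists_extend₂ hμ (φ - ψ' ≫ ρ) (by
        rw [Preadditive.comp_sub, hψ, assoc, sub_self])
      refine ⟨simpleMk p ℓ φ', ?_⟩
      rw [simpleMap_mk, ← hφ', sub_eq_add_neg, ← Preadditive.neg_comp, simpleMk_add,
        simpleMk_eq_zero_of_isRadTo p ℓ ha _ hρ, add_zero]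
    · rintro ⟨κ', hκ'⟩
      obtain ⟨φ', rfl⟩ := simpleMk_surjective p ℓ κ'
      rw [← simpleMap_mk, ← hκ', simpleMap_mk, simpleMap_mk, ← assoc, comp_eq_zero₁₂ hμ, zero_comp]
      rfl
  · obtain ⟨ψ, rfl⟩ := simpleMk_surjective p ℓ κ
    obtain ⟨ψ', rfl⟩ := exists_extend₁ hμ (homVanish_of_mem_addSet hp hx hℓ) ψ
    exact ⟨simpleMk p ℓ ψ', rfl⟩

end Exact

section SumDecomp

/-- Inclusions and projections exhibiting `y` as the direct sum of the family `f`. -/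
structure SumDecomp {n : ℕ} (y : C) (f : Fin n → C) where
  i (j : Fin n) : f j ⟶ y
  r (j : Fin n) : y ⟶ f j
  i_r_self (j : Fin n) : i j ≫ r j = 𝟙 _
  i_r_ne (j k : Fin n) (h : j ≠ k) : i j ≫ r k = 0
  total : ∑ j, r j ≫ i j = 𝟙 y

variable {n : ℕ} {y : C} {f : Fin n → C}

/-- The decomposition attached to an isomorphism with a biproduct. -/
noncomputable def SumDecomp.ofIso (e : y ≅ ⨁ f) : SumDecomp y f where
  i j := biproduct.ι f j ≫ e.inv
  r j := e.hom ≫ biproduct.π f j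
  i_r_self j := by simp
  i_r_ne j k h := by simp [biproduct.ι_π_ne f h]
  total := by
    calc _ = e.hom ≫ (∑ j, biproduct.π f j ≫ biproduct.ι f j) ≫ e.inv := by
          simp only [Preadditive.sum_comp, Preadditive.comp_sum, assoc]
      _ = _ := by rw [biproduct.total, id_comp, e.hom_inv_id]

/-- The isomorphism with the biproduct attached to a decomposition. -/
noncomputable def SumDecomp.iso (d : SumDecomp y f) : y ≅ ⨁ f where
  hom := biproduct.lift d.r
  inv := biproduct.desc d.i
  hom_inv_id := by rw [biproduct.lift_desc, d.total]
  inv_hom_id := by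
    ext j k
    by_cases h : j = k
    · subst h; simp [d.i_r_self]
    · simp [d.i_r_ne k j (Ne.symm h), biproduct.ι_π_ne f (Ne.symm h)]

/-- Shifting a decomposition. -/
noncomputable def SumDecomp.shift (d : SumDecomp y f) (a : ℤ) :
    SumDecomp (y⟦a⟧) (fun j => (f j)⟦a⟧) where
  i j := (d.i j)⟦a⟧'
  r j := (d.r j)⟦a⟧'
  i_r_self j := by rw [← Functor.map_comp, d.i_r_self, CategoryTheory.Functor.map_id]
  i_r_ne j k h := by rw [← Functor.map_comp, d.i_r_ne j k h, Functor.map_zero]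
  total := by
    simp only [← Functor.map_comp]
    rw [← Functor.map_sum, d.total, CategoryTheory.Functor.map_id]

end SumDecomp

section Length

lemma length_add_length_eq_of_exact {R M₁ M₂ M₃ M₄ M₅ : Type*} [Ring R]
    [AddCommGroup M₁] [AddCommGroup M₂] [AddCommGroup M₃] [AddCommGroup M₄] [AddCommGroup M₅]
    [Module R M₁] [Module R M₂] [Module R M₃] [Module R M₄] [Module R M₅]
    (a : M₁ →ₗ[R] M₂) (b : M₂ →ₗ[R] M₃) (c : M₃ →ₗ[R] M₄) (d : M₄ →ₗ[R] M₅)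
    (ha : Function.Injective a) (hab : Function.Exact a b) (hbc : Function.Exact b c)
    (hcd : Function.Exact c d) (hd : Function.Surjective d) :
    Module.length R M₂ + Module.length R M₄ =
      Module.length R M₁ + Module.length R M₃ + Module.length R M₅ := by
  rw [Module.length_eq_add_of_exact a b.rangeRestrict ha b.surjective_rangeRestrict (by
      intro x; rw [← hab x, ← Subtype.coe_inj]; rfl),
    Module.length_eq_add_of_exact (LinearMap.range b).subtype c.rangeRestrict
      (Submodule.subtype_injective _) c.surjective_rangeRestrict (by
        intro x; rw [← Subtype.coe_inj, Submodule.coe_subtype, Subtype.range_coe]; exact hbc x),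
    Module.length_eq_add_of_exact (LinearMap.range c).subtype d (Submodule.subtype_injective _) hd
      (by intro x; rw [Submodule.coe_subtype, Subtype.range_coe]; exact hcd x)]
  simp only [add_assoc, add_left_comm, add_comm]

lemma length_eq_sum_of_retracts {R M : Type*} [Ring R] [AddCommGroup M] [Module R M] {n : ℕ}
    {N : Fin n → Type*} [∀ j, AddCommGroup (N j)] [∀ j, Module R (N j)]
    (i : ∀ j, N j →ₗ[R] M) (r : ∀ j, M →ₗ[R] N j) (h₁ : ∀ j x, r j (i j x) = x)
    (h₂ : ∀ j k x, j ≠ k → r k (i j x) = 0) (h : ∀ m, ∑ j, i j (r j m) = m) :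
    Module.length R M = ∑ j, Module.length R (N j) := by
  let e : M ≃ₗ[R] (∀ j, N j) := LinearEquiv.ofLinearMap (LinearMap.pi r)
    (LinearMap.lsum R N ℕ i) (by
      ext j x k
      simp only [LinearMap.lsum_apply, LinearMap.comp_apply, LinearMap.sum_apply,
        LinearMap.pi_apply, LinearMap.single_apply, LinearMap.proj_apply, LinearMap.id_apply]
      rw [Finset.sum_eq_single j (fun b _ hb => by rw [Pi.single_eq_of_ne hb, map_zero])
        (by simp), Pi.single_eq_same]
      by_cases hjk : j = k
      · subst hjk; rw [h₁, Pi.single_eq_same]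
      · rw [h₂ j k x hjk, Pi.single_eq_of_ne (Ne.symm hjk)]) (by
      ext m
      simp [LinearMap.lsum_apply, h])
  rw [e.length_eq, Module.length_pi_of_fintype]

variable (p ℓ : C) [IsLocalRing (End ℓ)]

/-- The length of `SimpleHom`. -/
noncomputable def lenTop (w : C) : ℕ∞ := Module.length (End ℓ) (SimpleHom p ℓ w)

/-- The length of `NatSimple`. -/
noncomputable def lenNat (y : C) : ℕ∞ := Module.length (End ℓ) (NatSimple p ℓ y)

variable {p ℓ}

lemma lenTop_eq_sum {n : ℕ} {w : C} {f : Fin n → C} (d : SumDecomp w f) :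
    lenTop p ℓ w = ∑ j, lenTop p ℓ (f j) := by
  refine length_eq_sum_of_retracts (fun j => simpleMap p ℓ (d.r j))
    (fun j => simpleMap p ℓ (d.i j)) ?_ ?_ ?_
  · intro j κ
    rw [← simpleMap_comp, d.i_r_self, simpleMap_id]
  · intro j k κ h
    obtain ⟨φ, rfl⟩ := simpleMk_surjective p ℓ κ
    rw [← simpleMap_comp, d.i_r_ne _ _ h.symm, simpleMap_mk, zero_comp]
    rfl
  · intro κ
    obtain ⟨φ, rfl⟩ := simpleMk_surjective p ℓ κ
    simp only [simpleMap_mk]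
    refine (map_sum (radSub p ℓ w).mkQ _ _).symm.trans ?_
    simp only [← assoc]
    rw [← Preadditive.sum_comp, d.total, id_comp]
    rfl

lemma lenNat_eq_sum {n : ℕ} {w : C} {f : Fin n → C} (d : SumDecomp w f) :
    lenNat p ℓ w = ∑ j, lenNat p ℓ (f j) := by
  refine length_eq_sum_of_retracts (fun j => natMap p ℓ (d.r j))
    (fun j => natMap p ℓ (d.i j)) ?_ ?_ ?_
  · intro j τ
    ext a t : 3
    rw [natMap_apply, natMap_apply, assoc, d.i_r_self, comp_id]
  · intro j k τ h
    ext a t : 3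
    rw [natMap_apply, natMap_apply, assoc, d.i_r_ne _ _ h.symm, comp_zero, NatSimple.map_zero]
    rfl
  · intro τ
    ext a t : 3
    rw [Submodule.coe_sum, Finset.sum_apply, Finset.sum_apply]
    simp only [natMap_apply, assoc]
    refine (map_sum (AddMonoidHom.mk' (τ.1 a) (τ.2.1 a)) _ _).symm.trans ?_
    rw [← Preadditive.comp_sum, d.total, comp_id]
    rfl

lemma lenTop_self (hℓ : ℓ ∈ addSet p) : lenTop p ℓ ℓ = 1 := by
  refine Module.length_eq_one_iff.2 (isSimpleModule_iff_toSpanSingleton_surjective.2 ⟨?_, ?_⟩)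
  · refine ⟨simpleMk p ℓ (𝟙 ℓ), 0, fun h => ?_⟩
    obtain ⟨a, -, ψ, ρ, hρ, h⟩ := (simpleMk_eq_zero p ℓ).1 h
    exact hρ ψ (h ▸ inferInstance)
  · intro κ hκ
    obtain ⟨φ, rfl⟩ := simpleMk_surjective p ℓ κ
    have : IsIso φ := by
      by_contra hφ
      apply hκ
      rw [← id_comp φ]
      refine simpleMk_eq_zero_of_isRadTo p ℓ hℓ _ fun σ hσ => hφ ?_
      have hu : IsUnit (M := End ℓ) ((show End ℓ from φ) * (show End ℓ from σ)) :=
        (isUnit_end_iff_isIso (σ ≫ φ)).2 hσ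
      exact (isUnit_end_iff_isIso _).1 (isUnit_of_isUnit_mul_of_isLocalRing hu).1
    intro κ'
    obtain ⟨ψ, rfl⟩ := simpleMk_surjective p ℓ κ'
    refine ⟨(show End ℓ from inv φ ≫ ψ), ?_⟩
    change simpleMk p ℓ (φ ≫ inv φ ≫ ψ) = _
    rw [IsIso.hom_inv_id_assoc]

lemma lenTop_eq_zero {a : C} [IsLocalRing (End a)] (ha : a ∈ addSet p)
    (h : ¬ Nonempty (a ≅ ℓ)) : lenTop p ℓ a = 0 := by
  refine Module.length_eq_zero_iff.2 ⟨fun κ κ' => ?_⟩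
  have key (κ : SimpleHom p ℓ a) : κ = 0 := by
    obtain ⟨φ, rfl⟩ := simpleMk_surjective p ℓ κ
    rw [← id_comp φ]
    exact simpleMk_eq_zero_of_isRadTo p ℓ ha _ fun σ hσ => h
      ((nonempty_iso_of_isIso_comp σ φ hσ).map Iso.symm)
  rw [key κ, key κ']

lemma lenTop_le_of_iso {a b : C} (e : a ≅ b) : lenTop p ℓ a ≤ lenTop p ℓ b :=
  Module.length_le_of_surjective (simpleMap p ℓ e.hom) fun κ =>
    ⟨simpleMap p ℓ e.inv κ, by rw [← simpleMap_comp, e.hom_inv_id, simpleMap_id]⟩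

lemma lenTop_ne_top (hKS : KrullSchmidt C) (hℓ : ℓ ∈ addSet p) {a : C} (ha : a ∈ addSet p) :
    lenTop p ℓ a ≠ ⊤ := by
  obtain ⟨n, f, hf, ⟨e⟩⟩ := hKS a
  rw [lenTop_eq_sum (.ofIso e)]
  refine (ENat.sum_ne_top).2 fun j _ => ?_
  have := hf j
  by_cases h : Nonempty (f j ≅ ℓ)
  · exact ne_top_of_le_ne_top (by rw [lenTop_self hℓ]; exact ENat.one_ne_top)
      (lenTop_le_of_iso h.some)
  · rw [lenTop_eq_zero (addSet_trans (summand_mem_addSet e j) ha) h]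
    exact ENat.zero_ne_top

variable (hKS : KrullSchmidt C) (hp : HomVanish p p 1) (hℓ : ℓ ∈ addSet p)
include hKS hp hℓ

lemma lenNat_ne_top {z : C} (hz : z ∈ twoTermOf p) : lenNat p ℓ z ≠ ⊤ := by
  obtain ⟨z₁, z₀, hz₁, hz₀, f, g, h, hT⟩ := hz
  refine ne_top_of_le_ne_top (lenTop_ne_top hKS hℓ hz₀)
    (Module.length_le_of_injective (natEval p ℓ hz₀ g) ?_)
  refine (injective_iff_map_eq_zero _).2 fun τ hτ => ?_
  ext a t : 3
  obtain ⟨t', rfl⟩ := exists_lift_of_homVanish hT (homVanish_of_mem_addSet hp a.2 hz₁) t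
  rw [natEval_apply] at hτ
  rw [τ.2.2 ⟨z₀, hz₀⟩, hτ, map_zero]
  rfl

lemma lenTop_shift_ne_top {z : C} (hz : z ∈ twoTermOf p) : lenTop p ℓ (z⟦(-1 : ℤ)⟧) ≠ ⊤ := by
  obtain ⟨z₁, z₀, hz₁, hz₀, f, g, h, hT⟩ := hz
  obtain ⟨θ, hη⟩ := exists_invMor_distinguished hT
  refine ne_top_of_le_ne_top (lenTop_ne_top hKS hℓ hz₁)
    (Module.length_le_of_surjective (simpleMap p ℓ (invMor h)) fun κ => ?_)
  obtain ⟨ψ, rfl⟩ := simpleMk_surjective p ℓ κ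
  obtain ⟨ψ', rfl⟩ := exists_extend₁ hη (homVanish_of_mem_addSet hp hz₀ hℓ) ψ
  exact ⟨simpleMk p ℓ ψ', rfl⟩

variable (p ℓ) in
omit hKS hp hℓ in
/-- The multiplicity of `ℓ` in the class of `y` with respect to `p`. -/
noncomputable def index (y : C) : ℤ := (lenNat p ℓ y).toNat - (lenTop p ℓ (y⟦(-1 : ℤ)⟧)).toNat

lemma index_eq_sum {n : ℕ} {y : C} {f : Fin n → C} (d : SumDecomp y f)
    (hf : ∀ j, f j ∈ twoTermOf p) : index p ℓ y = ∑ j, index p ℓ (f j) := by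
  rw [index, lenNat_eq_sum d, lenTop_eq_sum (d.shift (-1)),
    ENat.toNat_sum fun j _ => lenNat_ne_top hKS hp hℓ (hf j),
    ENat.toNat_sum fun j _ => lenTop_shift_ne_top hKS hp hℓ (hf j)]
  simp [index]

lemma index_eq_add {x y z : C} {ι : x ⟶ y} {π : y ⟶ z}
    {δ : z ⟶ x⟦(1 : ℤ)⟧} (hT : Triangle.mk ι π δ ∈ distTriang C) (hx : x ∈ addSet p)
    (hz : z ∈ twoTermOf p) : index p ℓ y = index p ℓ z + (lenTop p ℓ x).toNat := by
  have h₁ := lenNat_ne_top hKS hp hℓ hz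
  have h₂ := lenTop_shift_ne_top hKS hp hℓ hz
  have h₃ := lenTop_ne_top hKS hℓ hx
  obtain ⟨z₁, z₀, hz₁, hz₀, f, g, h, hT'⟩ := hz
  obtain ⟨μ, hμ, hμ'⟩ := exists_exact_simpleMap hT hp hx hℓ
  have h₄ : lenTop p ℓ (y⟦(-1 : ℤ)⟧) ≠ ⊤ :=
    ne_top_of_le_ne_top h₂ (Module.length_le_of_surjective _ hμ')
  have key : lenNat p ℓ y + lenTop p ℓ (z⟦(-1 : ℤ)⟧) =
      lenNat p ℓ z + lenTop p ℓ x + lenTop p ℓ (y⟦(-1 : ℤ)⟧) :=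
    length_add_length_eq_of_exact (natMap p ℓ π) (natEval p ℓ hx ι) (simpleMap p ℓ (invMor δ))
      (simpleMap p ℓ μ) (natMap_injective hT hp hx) (exact_natMap_natEval hT hp hx)
      (exact_natEval_simpleMap hT hp hx hT' hz₁ hz₀) hμ hμ'
  have h₅ : lenNat p ℓ y ≠ ⊤ := by
    intro h
    rw [h, top_add] at key
    exact WithTop.add_ne_top.2 ⟨WithTop.add_ne_top.2 ⟨h₁, h₃⟩, h₄⟩ key.symm
  simp only [index]
  lift lenNat p ℓ y to ℕ using h₅ with A
  lift lenNat p ℓ z to ℕ using h₁ with B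
  lift lenTop p ℓ x to ℕ using h₃ with D
  lift lenTop p ℓ (y⟦(-1 : ℤ)⟧) to ℕ using h₄ with E
  lift lenTop p ℓ (z⟦(-1 : ℤ)⟧) to ℕ using h₂ with F
  simp only [ENat.toNat_natCast]
  have : A + F = B + D + E := by exact_mod_cast key
  omega

end Length

section Counting

lemma index_congr {p ℓ y y' : C} [IsLocalRing (End ℓ)] (e : y ≅ y') :
    index p ℓ y = index p ℓ y' := by
  let d : SumDecomp y (fun _ : Fin 1 => y') :=
    { i := fun _ => e.inv
      r := fun _ => e.hom
      i_r_self := fun _ => e.inv_hom_id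
      i_r_ne := fun j k h => absurd (Subsingleton.elim j k) h
      total := by simp }
  rw [index, index, lenNat_eq_sum d, lenTop_eq_sum (d.shift (-1))]
  simp

lemma comp_eq_zero₂₃ {x y z : C} {f : x ⟶ y} {g : y ⟶ z} {h : z ⟶ x⟦(1 : ℤ)⟧}
    (hT : Triangle.mk f g h ∈ distTriang C) : g ≫ h = 0 := comp_distTriang_mor_zero₂₃ _ hT

lemma comp_eq_zero₃₁ {x y z : C} {f : x ⟶ y} {g : y ⟶ z} {h : z ⟶ x⟦(1 : ℤ)⟧}
    (hT : Triangle.mk f g h ∈ distTriang C) : h ≫ f⟦(1 : ℤ)⟧' = 0 :=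
  comp_distTriang_mor_zero₃₁ _ hT

lemma exists_lift_shift {x y z a : C} {f : x ⟶ y} {g : y ⟶ z} {h : z ⟶ x⟦(1 : ℤ)⟧}
    (hT : Triangle.mk f g h ∈ distTriang C) (t : a ⟶ x⟦(1 : ℤ)⟧) (ht : t ≫ f⟦(1 : ℤ)⟧' = 0) :
    ∃ t' : a ⟶ z, t = t' ≫ h :=
  have hT' : Triangle.mk g h (-f⟦(1 : ℤ)⟧') ∈ distTriang C := rot_of_distTriang _ hT
  exists_lift₃ hT' t (by rw [Preadditive.comp_neg, ht, neg_zero])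

lemma exists_lift_shift_map {x y z a : C} {f : x ⟶ y} {g : y ⟶ z} {h : z ⟶ x⟦(1 : ℤ)⟧}
    (hT : Triangle.mk f g h ∈ distTriang C) (t : a ⟶ y⟦(1 : ℤ)⟧) (ht : t ≫ g⟦(1 : ℤ)⟧' = 0) :
    ∃ t' : a ⟶ x⟦(1 : ℤ)⟧, t = t' ≫ f⟦(1 : ℤ)⟧' := by
  have hT' : Triangle.mk g h (-f⟦(1 : ℤ)⟧') ∈ distTriang C := rot_of_distTriang _ hT
  obtain ⟨t', ht'⟩ := exists_lift_shift hT' t ht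
  exact ⟨-t', by rw [ht', Preadditive.comp_neg, Preadditive.neg_comp]⟩

variable (k : Type*) [CommRing k] [Linear k C]
  (hfin : ∀ X Y : C, Module.Finite k (X ⟶ Y)) {p q : C}
include hfin

lemma mem_twoTermOf_of_homVanish (hp : SiltingObj p) {z : C}
    (h₁ : ∀ i : ℤ, 1 ≤ i → HomVanish p z i) (h₂ : ∀ i : ℤ, 2 ≤ i → HomVanish z p i) :
    z ∈ twoTermOf p := by
  obtain ⟨a, ha, t, ht⟩ := exists_right_approx k hfin p z
  obtain ⟨x, f, h, hT⟩ := distinguished_cocone_triangle₁ t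
  have hpp : ∀ i : ℤ, 1 ≤ i → HomVanish p p i := hp.1
  refine ⟨x, a, hp.mem_addSet k hfin (fun i hi => ?_) (fun i hi => ?_), ha, f, t, h, hT⟩
  · rcases hi.eq_or_lt with rfl | hi
    · intro v
      obtain ⟨v', rfl⟩ := exists_lift_shift hT v (HomVanish.of_mem_right ha (hpp 1 le_rfl) _)
      obtain ⟨v'', rfl⟩ := ht v'
      rw [assoc, comp_eq_zero₂₃ hT, comp_zero]
    · exact HomVanish.obj₁ hT (.of_mem_right ha (hpp i (by lia))) (h₁ _ (by lia))
  · exact HomVanish.obj₁' hT (.of_mem_left ha (hpp i hi)) (h₂ _ (by lia))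

lemma exists_coresolution (hq : SiltingObj q) {x : C}
    (h₁ : ∀ i : ℤ, 2 ≤ i → HomVanish q x i) (h₂ : ∀ i : ℤ, 1 ≤ i → HomVanish x q i) :
    ∃ (q₀ q₁ : C) (_ : q₀ ∈ addSet q) (_ : q₁ ∈ addSet q) (f : x ⟶ q₀) (g : q₀ ⟶ q₁)
      (h : q₁ ⟶ x⟦(1 : ℤ)⟧), Triangle.mk f g h ∈ distTriang C := by
  obtain ⟨a, ha, t, ht⟩ := exists_left_approx k hfin x q
  obtain ⟨z, g, h, hT⟩ := distinguished_cocone_triangle t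
  have hqq : ∀ i : ℤ, 1 ≤ i → HomVanish q q i := hq.1
  refine ⟨a, z, ha, hq.mem_addSet k hfin (fun i hi => ?_) (fun i hi => ?_), t, g, h, hT⟩
  · exact HomVanish.obj₃ hT (.of_mem_right ha (hqq i hi)) (h₁ _ (by lia))
  · rcases hi.eq_or_lt with rfl | hi
    · intro v
      obtain ⟨v', rfl⟩ := exists_extend₃ hT v (HomVanish.of_mem_left ha (hqq 1 le_rfl) _)
      obtain ⟨v', rfl⟩ := (shiftFunctor C (1 : ℤ)).map_surjective v'
      obtain ⟨v'', rfl⟩ := ht v'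
      rw [Functor.map_comp, ← assoc, comp_eq_zero₃₁ hT, zero_comp]
    · exact HomVanish.obj₃' hT (.of_mem_left ha (hqq i (by lia))) (h₂ _ (by lia))

/-- If `p` and `q` are silting with `q ∈ add(p) * Σ add(p)`, then the indecomposable summands of `p`
are at most as numerous as those of `q`. -/
theorem card_summands_le (hKS : KrullSchmidt C) (hp : SiltingObj p) (hq : SiltingObj q)
    (h₁ : ∀ i : ℤ, 1 ≤ i → HomVanish p q i) (h₂ : ∀ i : ℤ, 2 ≤ i → HomVanish q p i)
    {n m : ℕ} {fp : Fin n → C} {fq : Fin m → C} (hfp : ∀ i, IsLocalRing (End (fp i)))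
    (hne : ∀ i j, Nonempty (fp i ≅ fp j) → i = j) (hmem : ∀ i, fp i ∈ addSet p)
    (hfq : ∀ i, IsLocalRing (End (fq i))) (e : q ≅ ⨁ fq) : n ≤ m := by
  have hpp : HomVanish p p 1 := hp.1 1 le_rfl
  have htwo (z : C) (hz : z ∈ addSet q) : z ∈ twoTermOf p :=
    mem_twoTermOf_of_homVanish k hfin hp (fun i hi => .of_mem_right hz (h₁ i hi))
      (fun i hi => .of_mem_left hz (h₂ i hi))
  let v (y : C) : Fin n → ℚ := fun j => index p (fp j) y
  let V := Submodule.span ℚ (Set.range fun j => v (fq j))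
  have hv (y : C) (hy : y ∈ addSet q) : v y ∈ V := by
    obtain ⟨N, f, hf, ⟨e'⟩⟩ := hKS y
    have hfm (j : Fin N) : f j ∈ addSet q := addSet_trans (summand_mem_addSet e' j) hy
    have : v y = ∑ j, v (f j) := by
      ext i
      rw [Finset.sum_apply]
      simp only [v]
      rw [index_eq_sum hKS hpp (hmem i) (.ofIso e') fun j => htwo _ (hfm j), Int.cast_sum]
    rw [this]
    refine Submodule.sum_mem _ fun j _ => ?_
    have := hf j
    obtain ⟨l, ⟨e''⟩⟩ := exists_iso_of_mem_addSet hfq e (hfm j)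
    have : v (f j) = v (fq l) := by
      ext i
      simp only [v]
      rw [index_congr e'']
    rw [this]
    exact Submodule.subset_span ⟨l, rfl⟩
  have hV : V = ⊤ := by
    rw [eq_top_iff, ← (Pi.basisFun ℚ (Fin n)).span_eq, Submodule.span_le]
    rintro _ ⟨i, rfl⟩
    obtain ⟨q₀, q₁, hq₀, hq₁, f, g, h, hT⟩ := exists_coresolution k hfin hq (x := fp i)
      (fun i' hi => .of_mem_right (hmem i) (h₂ i' hi))
      (fun i' hi => .of_mem_left (hmem i) (h₁ i' hi))
    have : Pi.basisFun ℚ (Fin n) i = v q₀ - v q₁ := by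
      ext j
      simp only [Pi.basisFun_apply, Pi.sub_apply, v]
      rw [index_eq_add hKS hpp (hmem j) hT (hmem i) (htwo _ hq₁)]
      by_cases hij : i = j
      · subst hij
        rw [lenTop_self (hmem i)]
        simp
      · have := hfp i
        rw [lenTop_eq_zero (hmem i) fun h => hij (hne i j h), Pi.single_eq_of_ne (Ne.symm hij)]
        simp
    rw [this]
    exact sub_mem (hv _ hq₀) (hv _ hq₁)
  have hcard := finrank_range_le_card (R := ℚ) fun j => v (fq j)
  rw [Set.finrank, show Submodule.span ℚ (Set.range fun j => v (fq j)) = ⊤ from hV, finrank_top]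
    at hcard
  simpa using hcard

end Counting

section Silting

lemma isLocalRing_end_shift {x : C} (hx : IsLocalRing (End x)) (a : ℤ) :
    IsLocalRing (End (x⟦a⟧)) := by
  let e : End x ≃* End (x⟦a⟧) :=
    (Functor.FullyFaithful.ofFullyFaithful (shiftFunctor C a)).mulEquivEnd x
  have : Nontrivial (End (x⟦a⟧)) := e.injective.nontrivial
  refine .of_isUnit_or_isUnit_one_sub_self fun f => ?_
  obtain ⟨g, rfl⟩ := e.surjective f
  have h : (1 : End (x⟦a⟧)) - e g = e (1 - g) := by
    rw [← map_one e]
    exact ((shiftFunctor C a).map_sub (f := (1 : End x)) (g := g)).symm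
  rw [h]
  exact (IsLocalRing.isUnit_or_isUnit_of_add_one (add_sub_cancel g 1)).imp
    (fun hu => hu.map e) (fun hu => hu.map e)

lemma SiltingObj.shift {s : C} (hs : SiltingObj s) : SiltingObj (s⟦(1 : ℤ)⟧) := by
  refine ⟨fun i hi => ?_, fun P hP hsP x => hs.2 P hP ?_ x⟩
  · exact (homVanish_shift_right 1 i).2
      ((homVanish_shift_left 1 _).2 (hs.1 _ (by lia)))
  · exact hP.1 _ _ ⟨shiftShiftNeg s (1 : ℤ)⟩ (hP.2.2.1 _ hsP)

lemma HomVanish.biprod_right {x y z : C} {n : ℤ} (hx : HomVanish z x n) (hy : HomVanish z y n) :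
    HomVanish z (x ⊞ y) n :=
  HomVanish.obj₂ (binaryBiproductTriangle_distinguished x y) hx hy

lemma HomVanish.biprod_left {x y z : C} {n : ℤ} (hx : HomVanish x z n) (hy : HomVanish y z n) :
    HomVanish (x ⊞ y) z n :=
  HomVanish.obj₂' (binaryBiproductTriangle_distinguished x y) hx hy

lemma IsThickSet.mem_of_mem_biprod {P : Set C} (hP : IsThickSet P) {x y : C}
    (h : (x ⊞ y : C) ∈ P) : x ∈ P ∧ y ∈ P :=
  ⟨hP.2.2.2.2 _ _ ⟨biprod.inl, biprod.fst, by simp⟩ h,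
    hP.2.2.2.2 _ _ ⟨biprod.inr, biprod.snd, by simp⟩ h⟩

lemma IsThickSet.mem_of_distinguished {P : Set C} (hP : IsThickSet P) {x y z : C} {f : x ⟶ y}
    {g : y ⟶ z} {h : z ⟶ x⟦(1 : ℤ)⟧} (hT : Triangle.mk f g h ∈ distTriang C) (hy : y ∈ P)
    (hz : z ∈ P) : x ∈ P := by
  obtain ⟨θ, hθ⟩ := exists_invMor_distinguished hT
  exact hP.2.2.2.1 _ _ _ _ _ _ hθ (hP.2.2.1 _ hz) hy

/-- Bongartz completion of a presilting object `u` of `add(s) * Σ add(s)`. -/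
lemma exists_bongartz_completion (k : Type*) [CommRing k] [Linear k C]
    (hfin : ∀ X Y : C, Module.Finite k (X ⟶ Y)) {s u : C} (hs : SiltingObj s)
    (hu : PresiltingObj u) (h₁ : ∀ i : ℤ, 1 ≤ i → HomVanish s u i)
    (h₂ : ∀ i : ℤ, 2 ≤ i → HomVanish u s i) :
    ∃ b u' : C, u' ∈ addSet u ∧ SiltingObj (u ⊞ b) ∧
      (∀ P : Set C, IsThickSet P → b ∈ P → u' ∈ P → s ∈ P) ∧
      (∀ i : ℤ, 1 ≤ i → HomVanish s b i) ∧ (∀ i : ℤ, 2 ≤ i → HomVanish b s i) := by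
  obtain ⟨u', hu', δ, hδ⟩ := exists_right_approx k hfin u (s⟦(1 : ℤ)⟧)
  obtain ⟨b, f, g, hT⟩ := distinguished_cocone_triangle₂ δ
  have hss : ∀ i : ℤ, 1 ≤ i → HomVanish s s i := hs.1
  have huu : ∀ i : ℤ, 1 ≤ i → HomVanish u u i := hu
  have hub : ∀ i : ℤ, 1 ≤ i → HomVanish u b i := fun i hi => by
    rcases hi.eq_or_lt with rfl | hi
    · intro v
      obtain ⟨v', rfl⟩ := exists_lift_shift_map hT v (HomVanish.of_mem_right hu' (huu 1 le_rfl) _)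
      obtain ⟨v'', rfl⟩ := hδ v'
      rw [assoc, comp_eq_zero₃₁ hT, comp_zero]
    · exact HomVanish.obj₂ hT (h₂ i (by lia)) (.of_mem_right hu' (huu i (by lia)))
  have hbu : ∀ i : ℤ, 1 ≤ i → HomVanish b u i := fun i hi =>
    HomVanish.obj₂' hT (h₁ i hi) (.of_mem_left hu' (huu i hi))
  have hsb : ∀ i : ℤ, 1 ≤ i → HomVanish s b i := fun i hi =>
    HomVanish.obj₂ hT (hss i hi) (.of_mem_right hu' (h₁ i hi))
  have hbb : ∀ i : ℤ, 1 ≤ i → HomVanish b b i := fun i hi =>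
    HomVanish.obj₂' hT (hsb i hi) (.of_mem_left hu' (hub i hi))
  have hsP : ∀ P : Set C, IsThickSet P → b ∈ P → u' ∈ P → s ∈ P := fun P hP hb hu'P =>
    hP.mem_of_distinguished hT hb hu'P
  refine ⟨b, u', hu', ⟨fun i hi => ?_, fun P hP hw => ?_⟩, hsP, hsb, fun i hi => ?_⟩
  · exact (HomVanish.biprod_left (huu i hi) (hbu i hi)).biprod_right
      (HomVanish.biprod_left (hub i hi) (hbb i hi))
  · obtain ⟨hu'', hb⟩ := hP.mem_of_mem_biprod hw
    exact hs.2 P hP (hsP P hP hb (hP.mem_of_mem_addSet hu'' hu'))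
  · exact HomVanish.obj₂' hT (hss i (by lia)) (.of_mem_left hu' (h₂ i hi))

end Silting

/-- In an essentially small, Krull–Schmidt, `k`-linear, Hom-finite triangulated
category with basic silting object `s`, a basic presilting object `u ∈ add(s) * Σ add(s)`
is silting iff it has the same number of indecomposable direct summands as `s`. -/
theorem stmt_9 (k : Type*) [CommRing k] [Linear k C] [EssentiallySmall C]
    (hfin : ∀ X Y : C, Module.Finite k (X ⟶ Y))
    (hKS : KrullSchmidt C)
    (s : C) (n : ℕ) (fs : Fin n → C) (hsb : BasicDecomp s n fs)
    (hs : SiltingObj s)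
    (u : C) (hu : u ∈ twoTermOf s) (hpre : PresiltingObj u)
    (m : ℕ) (fu : Fin m → C) (hub : BasicDecomp u m fu) :
    SiltingObj u ↔ m = n := by
  obtain ⟨hfs, hfs', ⟨es⟩⟩ := hsb
  obtain ⟨hfu, hfu', ⟨eu⟩⟩ := hub
  have hss : ∀ i : ℤ, 1 ≤ i → HomVanish s s i := hs.1
  obtain ⟨s₁, s₀, hs₁, hs₀, f, g, h, hT⟩ := hu
  have h₁ : ∀ i : ℤ, 1 ≤ i → HomVanish s u i := fun i hi =>
    HomVanish.obj₃ hT (.of_mem_right hs₀ (hss i hi)) (.of_mem_right hs₁ (hss _ (by lia)))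
  have h₂ : ∀ i : ℤ, 2 ≤ i → HomVanish u s i := fun i hi =>
    HomVanish.obj₃' hT (.of_mem_left hs₀ (hss i (by lia))) (.of_mem_left hs₁ (hss _ (by lia)))
  -- every silting object of `add(s) * Σ add(s)` has at most `n` indecomposable summands
  have hle {w : C} (hw : SiltingObj w) (hws : ∀ i : ℤ, 2 ≤ i → HomVanish w s i)
      (hsw : ∀ i : ℤ, 1 ≤ i → HomVanish s w i) {N : ℕ} {fw : Fin N → C}
      (hfw : ∀ i, IsLocalRing (End (fw i))) (hne : ∀ i j, Nonempty (fw i ≅ fw j) → i = j)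
      (hmem : ∀ i, fw i ∈ addSet w) : N ≤ n :=
    card_summands_le k hfin hKS hw hs.shift
      (fun i hi => (homVanish_shift_right 1 i).2 (hws _ (by lia)))
      (fun i hi => (homVanish_shift_left 1 i).2 (hsw _ (by lia))) hfw hne hmem
      (fun i => isLocalRing_end_shift (hfs i) 1) ((SumDecomp.ofIso es).shift 1).iso
  constructor
  · intro hsu
    exact le_antisymm (hle hsu h₂ h₁ hfu hfu' (summand_mem_addSet eu))
      (card_summands_le k hfin hKS hs hsu h₁ h₂ hfs hfs' (summand_mem_addSet es) hfu eu)
  · rintro rfl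
    obtain ⟨b, u', hu', hw, hsP, hsb, hbs⟩ := exists_bongartz_completion k hfin hs hpre h₁ h₂
    have hu_mem : u ∈ addSet (u ⊞ b) :=
      mem_addSet_of_retract biprod.inl biprod.fst (by simp) (mem_addSet_self _)
    have hb_mem : b ∈ addSet (u ⊞ b) :=
      mem_addSet_of_retract biprod.inr biprod.snd (by simp) (mem_addSet_self _)
    obtain ⟨N, fb, hfb, ⟨eb⟩⟩ := hKS b
    have hb : b ∈ addSet u := by
      refine mem_addSet_of_iso eb (biproduct_mem_addSet fun l => ?_)
      by_cases hl : ∃ j, Nonempty (fb l ≅ fu j)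
      · obtain ⟨j, ⟨e⟩⟩ := hl
        exact mem_addSet_of_iso e (summand_mem_addSet eu j)
      · exfalso
        have := hle hw (fun i hi => (h₂ i hi).biprod_left (hbs i hi))
          (fun i hi => (h₁ i hi).biprod_right (hsb i hi))
          (fw := Fin.cons (α := fun _ => C) (fb l) fu) ?_ ?_ ?_
        · lia
        · exact Fin.cases (hfb l) hfu
        · refine Fin.cases (Fin.cases (fun _ => rfl) fun j hj => ?_)
            fun i => Fin.cases (fun hi => ?_) fun j hij => ?_
          · exact (hl ⟨j, hj⟩).elim
          · exact (hl ⟨i, hi.map Iso.symm⟩).elim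
          · exact congrArg _ (hfu' i j hij)
        · exact Fin.cases (addSet_trans (summand_mem_addSet eb l) hb_mem)
            fun j => addSet_trans (summand_mem_addSet eu j) hu_mem
    exact ⟨hpre, fun P hP hP' => hs.2 P hP
      (hsP P hP (hP.mem_of_mem_addSet hP' hb) (hP.mem_of_mem_addSet hP' hu'))⟩
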